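/- For every integer n ≥ 3, every real c > 0 and every x ≥ 0, one has γ(x) = min{α(x), β(x)}; more precisely, α(x) > β(x) for 0 ≤ x < x₀ and α(x) < β(x) for x > x₀. -/

import Mathlib

open Real Filter

noncomputable def alphaF (n : ℕ) (c : ℝ) (x : ℝ) : ℝ :=
  (n : ℝ) * c + ((n : ℝ) / (2 * ((n : ℝ) - 1))) * x
    - (((n : ℝ) - 2) / (2 * ((n : ℝ) - 1))) * Real.sqrt (x ^ 2 + 4 * ((n : ℝ) - 1) * c * x)

noncomputable def yn (n : ℕ) : ℝ :=
  4 * (1 - (n : ℝ)) + (2 * ((n : ℝ) ^ 2 - 4) / Real.sqrt (2 * (n : ℝ) - 5)) *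
    Real.cos ((1 / 3) * Real.arctan (((n : ℝ) ^ 2 - 4 * (n : ℝ) + 6) /
      (2 * ((n : ℝ) - 1) * Real.sqrt (2 * (n : ℝ) - 5))))

noncomputable def x0 (n : ℕ) (c : ℝ) : ℝ := yn n * c

noncomputable def betaF (n : ℕ) (c : ℝ) (x : ℝ) : ℝ :=
  alphaF n c (x0 n c) + deriv (alphaF n c) (x0 n c) * (x - x0 n c)
    + (1 / 2) * deriv (deriv (alphaF n c)) (x0 n c) * (x - x0 n c) ^ 2

noncomputable def gammaF (n : ℕ) (c : ℝ) (x : ℝ) : ℝ :=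
  if x0 n c ≤ x then alphaF n c x else betaF n c x

noncomputable def gammaF' (n : ℕ) (c : ℝ) (x : ℝ) : ℝ :=
  derivWithin (gammaF n c) (Set.Ici 0) x

noncomputable def gammaF'' (n : ℕ) (c : ℝ) (x : ℝ) : ℝ :=
  derivWithin (gammaF' n c) (Set.Ici 0) x

noncomputable def omegaF (n : ℕ) (c : ℝ) (x : ℝ) : ℝ :=
  (x ^ 2 / Real.sqrt (x ^ 2 + 4 * ((n : ℝ) - 1) * c * x)) *
    ((1 + (n : ℝ) ^ 2 * c / x) *
      (((n : ℝ) / ((n : ℝ) - 2) - (1 + 4 * ((n : ℝ) - 1) * c / x) ^ (-(1 / 2) : ℝ)) /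
       ((n : ℝ) / ((n : ℝ) - 2) + (1 + 4 * ((n : ℝ) - 1) * c / x) ^ (-(1 / 2) : ℝ)))) ^ 2

/-- The node `yn n` is positive. -/
lemma yn_pos (n : ℕ) (hn : 3 ≤ n) : 0 < yn n := by
  have hn' : (3 : ℝ) ≤ n := by exact_mod_cast hn
  unfold yn
  generalize (n : ℝ) = m at *
  set r := Real.sqrt (2 * m - 5) with hr
  have hr0 : 0 < r := Real.sqrt_pos.2 (by linarith)
  have hr2 : r ^ 2 = 2 * m - 5 := Real.sq_sqrt (by linarith)
  set q := (m ^ 2 - 4 * m + 6) / (2 * (m - 1) * r)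
  have hq : 0 < q := by
    apply div_pos (by nlinarith [sq_nonneg (m - 2)])
    have : 0 < m - 1 := by linarith
    positivity
  have hcos : Real.sqrt 3 / 2 < Real.cos ((1 / 3) * Real.arctan q) := by
    rw [← Real.cos_pi_div_six]
    have h1 := Real.arctan_pos.2 hq
    have h2 := Real.arctan_lt_pi_div_two q
    apply Real.cos_lt_cos_of_nonneg_of_le_pi <;> linarith [Real.pi_pos]
  have hm4 : 0 < m ^ 2 - 4 := by nlinarith
  have hmain : 4 * (m - 1) * r ≤ (m ^ 2 - 4) * Real.sqrt 3 := by
    refine le_of_pow_le_pow_left₀ two_ne_zero (by positivity) ?_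
    rw [mul_pow, mul_pow _ (Real.sqrt 3), hr2, Real.sq_sqrt (by norm_num)]
    have h := mul_nonneg (sq_nonneg (m - 4))
      (show 0 ≤ 3 * m ^ 2 - 8 * m + 8 by nlinarith)
    linarith
  have h : 4 * (m - 1) < 2 * (m ^ 2 - 4) / r * Real.cos ((1 / 3) * Real.arctan q) := by
    rw [div_mul_eq_mul_div, lt_div_iff₀ hr0]
    nlinarith
  linarith

lemma hasDerivAt_sqrt_sq_add {a x : ℝ} (ha : 0 < a) (hx : 0 < x) :
    HasDerivAt (fun x => Real.sqrt (x ^ 2 + 2 * a * x))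
      ((x + a) / Real.sqrt (x ^ 2 + 2 * a * x)) x := by
  have h := (((hasDerivAt_id x).pow 2).add ((hasDerivAt_id x).const_mul (2 * a))).sqrt
    (by simp only [id, Pi.add_apply, Pi.pow_apply]; positivity)
  refine h.congr_deriv ?_
  change (2 * x ^ (2 - 1) * 1 + 2 * a * 1) / (2 * Real.sqrt (x ^ 2 + 2 * a * x)) = _
  have : 0 < Real.sqrt (x ^ 2 + 2 * a * x) := Real.sqrt_pos.2 (by positivity)
  field_simp
  ring

lemma hasDerivAt_div_sqrt_sq_add {a x : ℝ} (ha : 0 < a) (hx : 0 < x) :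
    HasDerivAt (fun x => (x + a) / Real.sqrt (x ^ 2 + 2 * a * x))
      (-a ^ 2 / Real.sqrt (x ^ 2 + 2 * a * x) ^ 3) x := by
  have hs : 0 < Real.sqrt (x ^ 2 + 2 * a * x) := Real.sqrt_pos.2 (by positivity)
  have h := ((hasDerivAt_id x).add_const a).div (hasDerivAt_sqrt_sq_add ha hx) hs.ne'
  refine h.congr_deriv ?_
  have h2 : Real.sqrt (x ^ 2 + 2 * a * x) ^ 2 = x ^ 2 + 2 * a * x :=
    Real.sq_sqrt (by positivity)
  rw [id]
  generalize Real.sqrt (x ^ 2 + 2 * a * x) = s at *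
  field_simp
  rw [h2]
  ring

/-- The difference between `√(x² + 2ax)` and its second order Taylor polynomial at `y`. -/
lemma sqrt_sub_taylor {a x y s t : ℝ} (ha : 0 < a) (hx : 0 ≤ x) (hy : 0 < y) (hs : 0 ≤ s)
    (ht : 0 < t) (hs2 : s ^ 2 = x ^ 2 + 2 * a * x) (ht2 : t ^ 2 = y ^ 2 + 2 * a * y) :
    s - (t + (y + a) / t * (x - y) + 1 / 2 * (-a ^ 2 / t ^ 3) * (x - y) ^ 2) =
      a ^ 2 * (x - y) ^ 2 / (2 * t ^ 3 * ((s + t) * ((x + a) * t + (y + a) * s))) *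
        ((s + t) * ((x + a) * t + (y + a) * s) - 2 * t ^ 2 * ((x + a) + (y + a))) := by
  have hst : 0 < s + t := by positivity
  have hp : 0 < (x + a) * t + (y + a) * s := by positivity
  have h1 : s - t = (x - y) * ((x + a) + (y + a)) / (s + t) := by
    rw [eq_div_iff hst.ne']
    linear_combination hs2 - ht2
  have h2 : (x + a) * t - (y + a) * s =
      -a ^ 2 * (x - y) * ((x + a) + (y + a)) / ((x + a) * t + (y + a) * s) := by
    rw [eq_div_iff hp.ne']
    linear_combination (x + a) ^ 2 * ht2 - (y + a) ^ 2 * hs2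
  have h3 : s - t - (y + a) / t * (x - y) =
      (x - y) * ((x + a) * t - (y + a) * s) / (t * (s + t)) := by
    rw [h1]
    field_simp
    ring
  have h4 : s - (t + (y + a) / t * (x - y) + 1 / 2 * (-a ^ 2 / t ^ 3) * (x - y) ^ 2) =
      (s - t - (y + a) / t * (x - y)) + a ^ 2 * (x - y) ^ 2 / (2 * t ^ 3) := by
    field_simp
    ring
  rw [h4, h3, h2]
  field_simp
  ring

lemma sqrt_lt_taylor {a x y s t : ℝ} (ha : 0 < a) (hx : 0 ≤ x) (hxy : x < y) (hs : 0 ≤ s)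
    (ht : 0 < t) (hs2 : s ^ 2 = x ^ 2 + 2 * a * x) (ht2 : t ^ 2 = y ^ 2 + 2 * a * y) :
    s < t + (y + a) / t * (x - y) + 1 / 2 * (-a ^ 2 / t ^ 3) * (x - y) ^ 2 := by
  have hst : s < t := lt_of_pow_lt_pow_left₀ 2 ht.le (by rw [hs2, ht2]; nlinarith)
  have hy : 0 < y := hx.trans_lt hxy
  rw [← sub_neg, sqrt_sub_taylor ha hx hy hs ht hs2 ht2]
  have h0 : 0 < (x - y) ^ 2 := by nlinarith
  apply mul_neg_of_pos_of_neg
  · positivity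
  · have h1 : (x + a) * t + (y + a) * s < t * ((x + a) + (y + a)) := by nlinarith
    have h2 : s + t < 2 * t := by linarith
    have := mul_lt_mul'' h2 h1 (by positivity) (by positivity)
    linarith

lemma taylor_lt_sqrt {a x y s t : ℝ} (ha : 0 < a) (hy : 0 < y) (hxy : y < x) (hs : 0 ≤ s)
    (ht : 0 < t) (hs2 : s ^ 2 = x ^ 2 + 2 * a * x) (ht2 : t ^ 2 = y ^ 2 + 2 * a * y) :
    t + (y + a) / t * (x - y) + 1 / 2 * (-a ^ 2 / t ^ 3) * (x - y) ^ 2 < s := by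
  have hst : t < s := lt_of_pow_lt_pow_left₀ 2 hs (by rw [hs2, ht2]; nlinarith)
  have hx : 0 < x := hy.trans hxy
  rw [← sub_pos, sqrt_sub_taylor ha hx.le hy hs ht hs2 ht2]
  have h0 : 0 < (x - y) ^ 2 := by nlinarith
  apply mul_pos
  · positivity
  · have h1 : t * ((x + a) + (y + a)) < (x + a) * t + (y + a) * s := by nlinarith
    have h2 : 2 * t < s + t := by linarith
    have := mul_lt_mul'' h2 h1 (by positivity) (by positivity)
    linarith

lemma hasDerivAt_alphaF {n : ℕ} {c x : ℝ} (ha : 0 < 2 * ((n : ℝ) - 1) * c) (hx : 0 < x) :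
    HasDerivAt (alphaF n c) ((n : ℝ) / (2 * ((n : ℝ) - 1)) - ((n : ℝ) - 2) / (2 * ((n : ℝ) - 1)) *
      ((x + 2 * ((n : ℝ) - 1) * c) /
        Real.sqrt (x ^ 2 + 2 * (2 * ((n : ℝ) - 1) * c) * x))) x := by
  have h := (((hasDerivAt_id x).const_mul ((n : ℝ) / (2 * ((n : ℝ) - 1)))).const_add
    ((n : ℝ) * c)).sub ((hasDerivAt_sqrt_sq_add ha hx).const_mul
      (((n : ℝ) - 2) / (2 * ((n : ℝ) - 1))))
  rw [mul_one] at h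
  refine h.congr_of_eventuallyEq (Eventually.of_forall fun z => ?_)
  simp only [alphaF, id, Pi.sub_apply]
  ring_nf

lemma deriv_deriv_alphaF {n : ℕ} {c x : ℝ} (ha : 0 < 2 * ((n : ℝ) - 1) * c) (hx : 0 < x) :
    deriv (deriv (alphaF n c)) x = -(((n : ℝ) - 2) / (2 * ((n : ℝ) - 1)) *
      (-(2 * ((n : ℝ) - 1) * c) ^ 2 /
        Real.sqrt (x ^ 2 + 2 * (2 * ((n : ℝ) - 1) * c) * x) ^ 3)) := by
  refine (((hasDerivAt_div_sqrt_sq_add ha hx).const_mul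
    (((n : ℝ) - 2) / (2 * ((n : ℝ) - 1)))).const_sub
      ((n : ℝ) / (2 * ((n : ℝ) - 1)))).congr_of_eventuallyEq ?_ |>.deriv
  filter_upwards [lt_mem_nhds hx] with z hz using (hasDerivAt_alphaF ha hz).deriv

/-- `α - β` is a multiple of the Taylor remainder of the square root. -/
lemma alphaF_sub_betaF {n : ℕ} {c : ℝ} (ha : 0 < 2 * ((n : ℝ) - 1) * c) (hy : 0 < x0 n c) (x : ℝ) :
    alphaF n c x - betaF n c x = ((n : ℝ) - 2) / (2 * ((n : ℝ) - 1)) *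
      (Real.sqrt (x0 n c ^ 2 + 2 * (2 * ((n : ℝ) - 1) * c) * x0 n c)
        + (x0 n c + 2 * ((n : ℝ) - 1) * c) /
          Real.sqrt (x0 n c ^ 2 + 2 * (2 * ((n : ℝ) - 1) * c) * x0 n c) * (x - x0 n c)
        + 1 / 2 * (-(2 * ((n : ℝ) - 1) * c) ^ 2 /
          Real.sqrt (x0 n c ^ 2 + 2 * (2 * ((n : ℝ) - 1) * c) * x0 n c) ^ 3) * (x - x0 n c) ^ 2
        - Real.sqrt (x ^ 2 + 2 * (2 * ((n : ℝ) - 1) * c) * x)) := by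
  rw [betaF, (hasDerivAt_alphaF ha hy).deriv, deriv_deriv_alphaF ha hy, alphaF, alphaF,
    show 4 * ((n : ℝ) - 1) * c = 2 * (2 * ((n : ℝ) - 1) * c) by ring]
  ring

theorem stmt_6 (n : ℕ) (hn : 3 ≤ n) (c : ℝ) (hc : 0 < c) :
    (∀ x : ℝ, 0 ≤ x → gammaF n c x = min (alphaF n c x) (betaF n c x)) ∧
    (∀ x : ℝ, 0 ≤ x → x < x0 n c → alphaF n c x > betaF n c x) ∧
    (∀ x : ℝ, x0 n c < x → alphaF n c x < betaF n c x) := by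
  have hn' : (3 : ℝ) ≤ n := by exact_mod_cast hn
  have hn1 : 0 < (n : ℝ) - 1 := by linarith
  have ha : 0 < 2 * ((n : ℝ) - 1) * c := by positivity
  have hk : 0 < ((n : ℝ) - 2) / (2 * ((n : ℝ) - 1)) := div_pos (by linarith) (by linarith)
  have hy : 0 < x0 n c := mul_pos (yn_pos n hn) hc
  have hlt : ∀ x : ℝ, 0 ≤ x → x < x0 n c → alphaF n c x > betaF n c x := by
    intro x hx hxy
    rw [gt_iff_lt, ← sub_pos, alphaF_sub_betaF ha hy]
    exact mul_pos hk (sub_pos.2 (sqrt_lt_taylor ha hx hxy (Real.sqrt_nonneg _)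
      (Real.sqrt_pos.2 (by positivity)) (Real.sq_sqrt (by positivity))
      (Real.sq_sqrt (by positivity))))
  have hgt : ∀ x : ℝ, x0 n c < x → alphaF n c x < betaF n c x := by
    intro x hxy
    have hx : 0 < x := hy.trans hxy
    rw [← sub_neg, alphaF_sub_betaF ha hy]
    exact mul_neg_of_pos_of_neg hk (sub_neg.2 (taylor_lt_sqrt ha hy hxy (Real.sqrt_nonneg _)
      (Real.sqrt_pos.2 (by positivity)) (Real.sq_sqrt (by positivity))
      (Real.sq_sqrt (by positivity))))
  refine ⟨fun x hx => ?_, hlt, hgt⟩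
  rcases lt_trichotomy x (x0 n c) with h | rfl | h
  · rw [gammaF, if_neg h.not_ge, min_eq_right (hlt x hx h).le]
  · simp [gammaF, betaF]
  · rw [gammaF, if_pos h.le, min_eq_left (hgt x h).le]
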